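/- arXiv:2305.06894 — 2 statements merged into one kernel-verified Lean document; each statement's English description precedes it below -/
import Mathlib

section
/- For every natural number n ≥ 1, the number of directed acyclic graphs on the labeled vertex set Fin n — that is, the number of relations r : Fin n → Fin n → Prop such that no vertex x satisfies Relation.TransGen r x x — is at most n! · 2^(n(n−1)/2). -/
/-- Every acyclic relation on a finite type admits a topological sort. -/
theorem exists_topologicalSort {α : Type*} [Fintype α] {n : ℕ} (hα : Fintype.card α = n)
    (r : α → α → Prop) (hr : ∀ x, ¬ Relation.TransGen r x x) :
    ∃ e : α ≃ Fin n, ∀ i j, r i j → e i < e j := by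
  have : IsPartialOrder α (Relation.ReflTransGen r) :=
    { refl := fun _ => .refl
      trans := fun _ _ _ => .trans
      antisymm := fun a b hab hba => by
        rcases Relation.reflTransGen_iff_eq_or_transGen.1 hab with h | h
        · exact h.symm
        · exact absurd (h.trans_left hba) (hr a) }
  obtain ⟨s, hs, hle⟩ := extend_partialOrder (Relation.ReflTransGen r)
  classical
  let : LinearOrder α :=
    { le := s
      le_refl := hs.refl
      le_trans := hs.trans
      le_antisymm := hs.antisymm
      le_total := hs.total
      toDecidableLE := Classical.decRel _ }
  let e : Fin n ≃o α := Fintype.orderIsoFinOfCardEq α hα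
  refine ⟨e.symm.toEquiv, fun i j hij => e.symm.lt_iff_lt.2 (lt_of_le_of_ne ?_ ?_)⟩
  · exact hle _ _ (.single hij)
  · rintro rfl
    exact hr i (.single hij)

/-- The number of directed acyclic graphs on the labeled vertex set `Fin n`, i.e. the
number of relations `r : Fin n → Fin n → Prop` with no directed cycle (no `x` with
`Relation.TransGen r x x`), is at most `n! * 2 ^ (n * (n - 1) / 2)`. -/
theorem card_dags_le (n : ℕ) (hn : 1 ≤ n) :
    Nat.card {r : Fin n → Fin n → Prop // ∀ x, ¬ Relation.TransGen r x x}
      ≤ n.factorial * 2 ^ (n * (n - 1) / 2) := by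
  classical
  choose e he using fun r : {r : Fin n → Fin n → Prop // ∀ x, ¬ Relation.TransGen r x x} =>
    exists_topologicalSort (Fintype.card_fin n) r.1 r.2
  -- Record a topological sort together with the edges between pairs in increasing position.
  let code (r : {r : Fin n → Fin n → Prop // ∀ x, ¬ Relation.TransGen r x x}) :
      Equiv.Perm (Fin n) × ((Σ j : Fin n, Fin j) → Prop) :=
    (e r, fun p => r.1 ((e r).symm ⟨p.2, p.2.2.trans p.1.2⟩) ((e r).symm p.1))
  have edge_iff (r i j) :
      r.1 i j ↔ ∃ h : (code r).1 i < (code r).1 j, (code r).2 ⟨(code r).1 j, ⟨(code r).1 i, h⟩⟩ := by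
    simpa [code] using he r i j
  have code_injective : Function.Injective code := by
    intro r s hrs
    ext i j
    rw [edge_iff r, edge_iff s, hrs]
  refine (Nat.card_le_card_of_injective code code_injective).trans_eq ?_
  simp [Nat.card_eq_fintype_card, Fintype.card_perm, Fin.sum_univ_eq_sum_range (fun i => i),
    Finset.sum_range_id]
end

section
/- There exists a constant C > 0 such that for every n ≥ 1 the following holds. For parameters α : Fin n → ℝ and s : Fin n → {0,1}, define the real-valued function ρ_{α,s} on ordered pairs by ρ_{α,s}(j,k) = (−1)^{s_j + s_k} · exp(−|α_j − α_k|), and consider the class of threshold classifiers 𝒞 = { (j,k) ↦ 𝟙[ρ_{α,s}(j,k) ≥ γ] : α ∈ ℝⁿ, s ∈ {0,1}ⁿ, γ ∈ ℝ }. Then every finite set of pairs in Fin n × Fin n shattered by 𝒞 has cardinality at most C·n; i.e., the VC dimension of the class of correlation predictors induced by collider-free paths with prescribed adjacent correlations is in O(n). -/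
open Finset in
/-- A family of linear functionals whose nonnegativity patterns realise every subset of its
index set has at most `finrank` many members. -/
theorem card_le_finrank_of_nonneg_patterns {E ι : Type*} [AddCommGroup E] [Module ℝ E]
    [FiniteDimensional ℝ E] (f : ι → E →ₗ[ℝ] ℝ) (T : Finset ι)
    (hT : ∀ t ⊆ T, ∃ x : E, ∀ i ∈ T, 0 ≤ f i x ↔ i ∈ t) :
    #T ≤ Module.finrank ℝ E := by
  classical
  by_contra! hlt
  have key : ∀ c : ι → ℝ, (∀ x, ∑ i ∈ T, c i * f i x = 0) → ∀ i ∈ T, 0 ≤ c i := by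
    intro c hc i hi
    by_contra! hneg
    obtain ⟨x, hx⟩ := hT (T.filter fun i => 0 ≤ c i) (filter_subset _ _)
    have hpos : ∀ j ∈ T, c j < 0 → 0 < c j * f j x := fun j hj hcj =>
      mul_pos_of_neg_of_neg hcj <| by
        by_contra! hf
        exact absurd (mem_filter.1 ((hx j hj).1 hf)).2 (not_le.2 hcj)
    refine (sum_pos' (fun j hj => ?_) ⟨i, hi, hpos i hi hneg⟩).ne' (hc x)
    rcases lt_or_ge (c j) 0 with h | h
    · exact (hpos j hj h).le
    · exact mul_nonneg h ((hx j hj).2 (mem_filter.2 ⟨hj, h⟩))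
  have hdep : ¬ LinearIndepOn ℝ f (T : Set ι) := by
    intro h
    have h' := LinearIndependent.fintype_card_le_finrank h
    have hdual : Module.finrank ℝ (E →ₗ[ℝ] ℝ) = Module.finrank ℝ E :=
      Subspace.dual_finrank_eq
    rw [hdual] at h'
    simp at h'
    omega
  rw [linearIndepOn_finset_iff] at hdep
  push Not at hdep
  obtain ⟨c, hc, i, hi, hci⟩ := hdep
  have hc' : ∀ x, ∑ i ∈ T, c i * f i x = 0 := fun x => by
    simpa using congrArg (fun g : E →ₗ[ℝ] ℝ => g x) hc
  have h₁ := key c hc' i hi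
  have h₂ := key (-c) (fun x => by simp [hc']) i hi
  simp only [Pi.neg_apply] at h₂
  exact hci (by linarith)

open Finset in
/-- Exponential bound on partial sums of binomial coefficients. -/
theorem sum_Iic_choose_le {d D : ℕ} (hd : d ≤ D) (M : ℕ) :
    (∑ k ∈ Iic d, (M.choose k : ℝ)) ≤ 16 ^ D * (17 / 16) ^ M := by
  have hbin : ∑ k ∈ range (M + 1), (1 / 16 : ℝ) ^ k * M.choose k = (17 / 16) ^ M := by
    have h := add_pow (1 / 16 : ℝ) 1 M
    norm_num at h ⊢
    exact h.symm
  calc (∑ k ∈ Iic d, (M.choose k : ℝ))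
      ≤ ∑ k ∈ Iic d, 16 ^ D * ((1 / 16 : ℝ) ^ k * M.choose k) := by
        refine sum_le_sum fun k hk => ?_
        have hk' : k ≤ D := (mem_Iic.1 hk).trans hd
        have hone : (1 : ℝ) ≤ 16 ^ D * (1 / 16) ^ k := by
          rw [one_div, inv_pow, ← div_eq_mul_inv, one_le_div (by positivity)]
          exact pow_le_pow_right₀ (by norm_num) hk'
        rw [← mul_assoc]
        exact le_mul_of_one_le_left (by positivity) hone
    _ = 16 ^ D * ∑ k ∈ Iic d, (1 / 16 : ℝ) ^ k * M.choose k := by rw [mul_sum]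
    _ ≤ 16 ^ D * ∑ k ∈ range (M + 1), (1 / 16 : ℝ) ^ k * M.choose k := by
        gcongr ?_ * ?_
        rw [sum_subset (subset_union_left : range (M + 1) ⊆ range (M + 1) ∪ Iic d) fun k _ hk => ?_]
        · exact sum_le_sum_of_subset_of_nonneg subset_union_right fun k _ _ => by positivity
        · rw [mem_range, not_lt] at hk
          simp [Nat.choose_eq_zero_of_lt (Nat.lt_of_succ_le hk)]
    _ = 16 ^ D * (17 / 16) ^ M := by rw [hbin]

open Finset in
/-- A finite family of linear functionals has few nonnegativity patterns. -/
theorem card_nonneg_patterns_le {E ι : Type*} [AddCommGroup E] [Module ℝ E]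
    [FiniteDimensional ℝ E] [Fintype ι] [DecidableEq ι] (f : ι → E →ₗ[ℝ] ℝ)
    (𝒜 : Finset (Finset ι)) (h𝒜 : ∀ A ∈ 𝒜, ∃ x : E, ∀ i, 0 ≤ f i x ↔ i ∈ A) :
    (#𝒜 : ℝ) ≤ 16 ^ Module.finrank ℝ E * (17 / 16) ^ Fintype.card ι := by
  have hvc : 𝒜.vcDim ≤ Module.finrank ℝ E := by
    refine Finset.sup_le fun T hT => card_le_finrank_of_nonneg_patterns f T fun t ht => ?_
    obtain ⟨A, hA, rfl⟩ := (mem_shatterer.1 hT) ht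
    obtain ⟨x, hx⟩ := h𝒜 A hA
    exact ⟨x, fun i hi => by simp [hx i, hi]⟩
  have hcard := (card_le_card_shatterer 𝒜).trans card_shatterer_le_sum_vcDim
  calc (#𝒜 : ℝ) ≤ ∑ k ∈ Iic 𝒜.vcDim, ((Fintype.card ι).choose k : ℝ) := by
        exact_mod_cast hcard
    _ ≤ _ := sum_Iic_choose_le hvc _

/-- The linear functional `(α, t) ↦ t - (α j - α k)`, or `(α, t) ↦ t - (α k - α j)`,
depending on the Boolean. -/
def gapFunctional {n : ℕ} (p : Fin n × Fin n) (c : Bool) : (Fin n → ℝ) × ℝ →ₗ[ℝ] ℝ :=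
  LinearMap.snd ℝ _ _ - (bif c then (1 : ℝ) else -1) •
    (((LinearMap.proj p.1 : (Fin n → ℝ) →ₗ[ℝ] ℝ) - LinearMap.proj p.2) ∘ₗ LinearMap.fst ℝ _ _)

theorem gapFunctional_true {n : ℕ} (p : Fin n × Fin n) (x : (Fin n → ℝ) × ℝ) :
    gapFunctional p true x = x.2 - (x.1 p.1 - x.1 p.2) := by
  simp [gapFunctional]

theorem gapFunctional_false {n : ℕ} (p : Fin n × Fin n) (x : (Fin n → ℝ) × ℝ) :
    gapFunctional p false x = x.2 + (x.1 p.1 - x.1 p.2) := by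
  simp [gapFunctional]
  ring

/-- Thresholding the correlations of a path amounts to testing parities of signs together with
nonnegativity of linear functionals: a conjunction for a positive threshold, a disjunction
otherwise. -/
theorem exists_gapFunctional_of_threshold {n : ℕ} (α : Fin n → ℝ) (s : Fin n → Fin 2) (γ : ℝ) :
    ∃ c : Bool, ∃ x : (Fin n → ℝ) × ℝ, ∀ p : Fin n × Fin n,
      (γ ≤ (-1 : ℝ) ^ ((s p.1 : ℕ) + (s p.2 : ℕ)) * Real.exp (-|α p.1 - α p.2|)) ↔
        (bif c then
          Even ((s p.1 : ℕ) + (s p.2 : ℕ)) ∧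
            0 ≤ gapFunctional p true x ∧ 0 ≤ gapFunctional p false x
        else
          Even ((s p.1 : ℕ) + (s p.2 : ℕ)) ∨
            0 ≤ gapFunctional p true x ∨ 0 ≤ gapFunctional p false x) := by
  rcases lt_trichotomy γ 0 with hγ | rfl | hγ
  · refine ⟨false, (-α, Real.log (-γ)), fun p => ?_⟩
    have hexp := Real.exp_pos (-|α p.1 - α p.2|)
    simp only [gapFunctional_true, gapFunctional_false, cond_false, Pi.neg_apply]
    rcases Nat.even_or_odd ((s p.1 : ℕ) + (s p.2 : ℕ)) with h | h
    · simp only [h, h.neg_one_pow, true_or, iff_true]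
      linarith
    · rw [h.neg_one_pow, neg_one_mul, le_neg, ← Real.le_log_iff_exp_le (by linarith), neg_le,
        le_abs]
      simp only [Nat.not_even_iff_odd.2 h, false_or]
      constructor <;> rintro (h | h) <;> first | (left; linarith) | (right; linarith)
  · refine ⟨false, (0, -1), fun p => ?_⟩
    have hexp := Real.exp_pos (-|α p.1 - α p.2|)
    simp only [gapFunctional_true, gapFunctional_false, cond_false, Pi.zero_apply]
    rcases Nat.even_or_odd ((s p.1 : ℕ) + (s p.2 : ℕ)) with h | h
    · simp [h, h.neg_one_pow, hexp.le]
    · simp only [Nat.not_even_iff_odd.2 h, h.neg_one_pow]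
      norm_num [hexp]
  · refine ⟨true, (α, -Real.log γ), fun p => ?_⟩
    have hexp := Real.exp_pos (-|α p.1 - α p.2|)
    simp only [gapFunctional_true, gapFunctional_false, cond_true]
    rcases Nat.even_or_odd ((s p.1 : ℕ) + (s p.2 : ℕ)) with h | h
    · rw [h.neg_one_pow, one_mul, ← Real.log_le_iff_le_exp hγ, le_neg, abs_le]
      simp only [h, true_and]
      constructor <;> rintro ⟨h₁, h₂⟩ <;> constructor <;> linarith
    · simp only [Nat.not_even_iff_odd.2 h, h.neg_one_pow, false_and, iff_false]
      linarith

open Finset in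
/-- A set of pairs shattered by the threshold classifiers satisfies the exponential inequality
obtained from counting its labelings. -/
theorem two_pow_card_le_of_shattered {n : ℕ} (S : Finset (Fin n × Fin n))
    (hS : ∀ b : Fin n × Fin n → Bool,
      ∃ α : Fin n → ℝ, ∃ s : Fin n → Fin 2, ∃ γ : ℝ,
        ∀ p ∈ S, (γ ≤ (-1 : ℝ) ^ ((s p.1 : ℕ) + (s p.2 : ℕ)) *
          Real.exp (-|α p.1 - α p.2|) ↔ b p = true)) :
    (2 : ℝ) ^ #S ≤ 2 * 2 ^ n * (16 ^ (n + 1) * (17 / 16) ^ (#S * 2)) := by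
  classical
  let f : S × Bool → ((Fin n → ℝ) × ℝ →ₗ[ℝ] ℝ) := fun i => gapFunctional i.1.1 i.2
  let 𝒜 : Finset (Finset (S × Bool)) :=
    univ.filter fun A => ∃ x, ∀ i, 0 ≤ f i x ↔ i ∈ A
  have hcode : ∀ B : Finset S, ∃ code : Bool × (Fin n → Fin 2) × 𝒜, ∀ p : S, p ∈ B ↔
      (bif code.1 then
        Even ((code.2.1 p.1.1 : ℕ) + (code.2.1 p.1.2 : ℕ)) ∧
          (p, true) ∈ code.2.2.1 ∧ (p, false) ∈ code.2.2.1
      else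
        Even ((code.2.1 p.1.1 : ℕ) + (code.2.1 p.1.2 : ℕ)) ∨
          (p, true) ∈ code.2.2.1 ∨ (p, false) ∈ code.2.2.1) := by
    intro B
    obtain ⟨α, s, γ, h⟩ := hS fun p => decide (∃ hp : p ∈ S, (⟨p, hp⟩ : S) ∈ B)
    obtain ⟨c, x, hx⟩ := exists_gapFunctional_of_threshold α s γ
    refine ⟨(c, s, ⟨univ.filter fun i => 0 ≤ f i x, ?_⟩), fun p => ?_⟩
    · exact mem_filter.2 ⟨mem_univ _, x, by simp⟩
    · have hp := (h p.1 p.2).symm.trans (hx p.1)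
      simpa [f] using hp
  choose code hcode using hcode
  have hinj : Function.Injective code := fun B B' hBB' => by
    ext p
    rw [hcode B p, hcode B' p, hBB']
  have hcard := Fintype.card_le_of_injective code hinj
  have h𝒜 := card_nonneg_patterns_le f 𝒜 fun A hA => (mem_filter.1 hA).2
  have hrank : Module.finrank ℝ ((Fin n → ℝ) × ℝ) = n + 1 := by simp
  rw [hrank] at h𝒜
  simp only [Fintype.card_prod, Fintype.card_finset, Fintype.card_coe, Fintype.card_bool,
    Fintype.card_pi, Fintype.card_fin, prod_const, card_univ] at hcard h𝒜
  calc (2 : ℝ) ^ #S ≤ 2 * 2 ^ n * #𝒜 := by rw [mul_assoc]; exact_mod_cast hcard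
    _ ≤ _ := by gcongr

/-- The VC dimension of the class of correlation predictors induced by collider-free
paths with prescribed adjacent correlations is in `O(n)`: there is a constant `C > 0`
such that for every `n ≥ 1`, every finite set of pairs shattered by the threshold
classifiers `(j,k) ↦ 𝟙[ρ_{α,s}(j,k) ≥ γ]` with
`ρ_{α,s}(j,k) = (-1)^(s_j + s_k) · exp(-|α_j - α_k|)` has cardinality at most `C·n`. -/
theorem vc_correlation_predictors_bigO :
    ∃ C : ℝ, 0 < C ∧ ∀ n : ℕ, 1 ≤ n →
      ∀ S : Finset (Fin n × Fin n),
        (∀ b : Fin n × Fin n → Bool,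
          ∃ α : Fin n → ℝ, ∃ s : Fin n → Fin 2, ∃ γ : ℝ,
            ∀ p ∈ S,
              (γ ≤ (-1 : ℝ) ^ ((s p.1 : ℕ) + (s p.2 : ℕ)) *
                  Real.exp (-|α p.1 - α p.2|) ↔ b p = true)) →
        (S.card : ℝ) ≤ C * n := by
  refine ⟨20, by norm_num, fun n hn S hS => ?_⟩
  have hcount := two_pow_card_le_of_shattered S hS
  set m := S.card
  have hsq : (2 : ℝ) ^ m * 2 ^ m ≤ 2 ^ (10 * (n + 1)) * 2 ^ m := by
    calc (2 : ℝ) ^ m * 2 ^ m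
        ≤ (2 * 2 ^ n * (16 ^ (n + 1) * (17 / 16) ^ (m * 2))) *
          (2 * 2 ^ n * (16 ^ (n + 1) * (17 / 16) ^ (m * 2))) := by gcongr
      _ = (2 ^ (n + 1) * 2 ^ (n + 1) * (16 ^ (n + 1) * 16 ^ (n + 1))) *
          ((17 / 16 : ℝ) ^ 4) ^ m := by
        rw [← pow_mul, show 4 * m = m * 2 + m * 2 by ring, pow_add, pow_succ 2 n]
        ring
      _ = 2 ^ (10 * (n + 1)) * ((17 / 16 : ℝ) ^ 4) ^ m := by
        rw [← mul_pow, ← mul_pow, ← mul_pow, pow_mul]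
        norm_num
      _ ≤ 2 ^ (10 * (n + 1)) * 2 ^ m := by gcongr; norm_num
  have hpow : (2 : ℝ) ^ m ≤ 2 ^ (10 * (n + 1)) := le_of_mul_le_mul_right hsq (by positivity)
  have hm : m ≤ 10 * (n + 1) := (pow_le_pow_iff_right₀ (by norm_num)).1 hpow
  have hm' : m ≤ 20 * n := by omega
  exact_mod_cast hm'
end
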